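/- Let G be a finite group, N ⊴ G, and θ an irreducible character in the principal p-block of N that extends to a character χ in the principal p-block of G. Then for every irreducible character μ of G/N lying in the principal p-block of G/N, the product μχ lies in the principal p-block of G. -/

import Mathlib

/-- `χ` is the character of an irreducible complex representation of `G`. -/
def IsIrredChar (G : Type) [Group G] (χ : G → ℂ) : Prop :=
  ∃ V : FDRep ℂ G, CategoryTheory.Simple V ∧ ∀ g, V.character g = χ g

/-- The size of the conjugacy class of `g`. -/
noncomputable def classCard {G : Type*} [Group G] (g : G) : ℕ := Nat.card {x : G // IsConj g x}

/-- `χ` lies in the principal `p`-block of `G`, with respect to the maximal ideal `M` of the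
ring of algebraic integers: the central character of `χ` is congruent mod `M` to that of the
trivial character. -/
def InPrincipalBlock (G : Type) [Group G] [Finite G] (M : Ideal (integralClosure ℤ ℂ))
    (χ : G → ℂ) : Prop :=
  ∀ g : G, ∃ z : integralClosure ℤ ℂ,
    (z : ℂ) = (classCard g) * χ g / χ 1 - (classCard g) ∧ z ∈ M

namespace Representation

section Schur

variable {k G V : Type*} [Field k] [Group G] [AddCommGroup V] [Module k V]
  (ρ : Representation k G V)

/-- If the endomorphism algebra of a representation is one-dimensional, then every linear
endomorphism commuting with the action is a scalar. -/
theorem exists_eq_smul_one_of_finrank_intertwiningMap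
    (h : Module.finrank k (IntertwiningMap ρ ρ) = 1) (f : Module.End k V)
    (hf : ∀ g, f * ρ g = ρ g * f) : ∃ c : k, f = c • 1 := by
  obtain ⟨v, hv, hspan⟩ := finrank_eq_one_iff'.mp h
  obtain ⟨a, ha⟩ := hspan ⟨1, fun g => by ext; simp⟩
  obtain ⟨c, hc⟩ := hspan ⟨f, hf⟩
  replace ha : a • v.toLinearMap = 1 := congrArg IntertwiningMap.toLinearMap ha
  replace hc : c • v.toLinearMap = f := congrArg IntertwiningMap.toLinearMap hc
  have ha0 : a ≠ 0 := by
    rintro rfl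
    rw [zero_smul] at ha
    refine hv (IntertwiningMap.ext ?_)
    change v.toLinearMap = 0
    rw [← mul_one (M := Module.End k V) v.toLinearMap, ← ha, mul_zero]
  exact ⟨c * a⁻¹, by rw [← hc, ← ha, smul_smul, inv_mul_cancel_right₀ ha0]⟩

variable [Fintype G] [FiniteDimensional k V]

theorem finrank_smul_sum_conj
    (hρ : ∀ f : Module.End k V, (∀ g, f * ρ g = ρ g * f) → ∃ c : k, f = c • 1)
    (A : Module.End k V) :
    (Module.finrank k V : k) • ∑ g, ρ g * A * ρ g⁻¹ =
      ((Nat.card G : k) * LinearMap.trace k V A) • (1 : Module.End k V) := by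
  obtain ⟨c, hc⟩ := hρ (∑ g, ρ g * A * ρ g⁻¹) fun h => by
    rw [Finset.sum_mul, Finset.mul_sum, ← Equiv.sum_comp (Equiv.mulLeft h)]
    refine Finset.sum_congr rfl fun g _ => ?_
    simp only [Equiv.coe_mulLeft, mul_inv_rev, map_mul, mul_assoc]
    rw [← map_mul ρ h⁻¹ h, inv_mul_cancel, map_one, mul_one]
  have htr := congrArg (LinearMap.trace k V) hc
  have hconj (g : G) : LinearMap.trace k V (ρ g * A * ρ g⁻¹) = LinearMap.trace k V A := by
    rw [LinearMap.trace_mul_comm, ← mul_assoc, ← map_mul, inv_mul_cancel, map_one, one_mul]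
  simp only [map_sum, hconj, Finset.sum_const, Finset.card_univ, map_smul, LinearMap.trace_one,
    nsmul_eq_mul, smul_eq_mul, Fintype.card_eq_nat_card] at htr
  rw [hc, smul_smul, htr, mul_comm]

/-- The Schur orthogonality relations in terms of traces. -/
theorem finrank_mul_sum_trace_mul_trace
    (hρ : ∀ f : Module.End k V, (∀ g, f * ρ g = ρ g * f) → ∃ c : k, f = c • 1)
    (S T : Module.End k V) :
    (Module.finrank k V : k) *
        ∑ g, LinearMap.trace k V (S * ρ g) * LinearMap.trace k V (ρ g⁻¹ * T) =
      (Nat.card G : k) * LinearMap.trace k V (S * T) := by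
  classical
  set b := Module.finBasis k V
  have htr (f : Module.End k V) : LinearMap.trace k V f = ∑ i, b.coord i (f (b i)) := by
    simp [LinearMap.trace_eq_matrix_trace k b, Matrix.trace, LinearMap.toMatrix_apply]
  have hprod (g : G) : LinearMap.trace k V (S * ρ g) * LinearMap.trace k V (ρ g⁻¹ * T) =
      ∑ i, ∑ j, b.coord i
        (S ((ρ g * (b.coord j).smulRight (b i) * ρ g⁻¹ : Module.End k V) (T (b j)))) := by
    rw [htr, htr, Finset.sum_mul_sum]
    refine Finset.sum_congr rfl fun i _ => Finset.sum_congr rfl fun j _ => ?_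
    simp [Module.End.mul_apply, mul_comm]
  have hunit (i j) : LinearMap.trace k V ((b.coord j).smulRight (b i)) = if i = j then 1 else 0 := by
    simp [LinearMap.trace_smulRight, Finsupp.single_apply]
  simp only [hprod]
  rw [Finset.sum_comm, Finset.mul_sum, htr, Finset.mul_sum]
  refine Finset.sum_congr rfl fun i _ => ?_
  rw [Finset.sum_comm, Finset.mul_sum, Finset.sum_eq_single i]
  · have := congrArg (fun f : Module.End k V => b.coord i (S (f (T (b i)))))
      (finrank_smul_sum_conj ρ hρ ((b.coord i).smulRight (b i)))
    simpa [hunit, LinearMap.sum_apply] using this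
  · intro j _ hj
    have := congrArg (fun f : Module.End k V => b.coord i (S (f (T (b j)))))
      (finrank_smul_sum_conj ρ hρ ((b.coord j).smulRight (b i)))
    simpa [hunit, LinearMap.sum_apply, hj.symm] using this
  · simp

end Schur

end Representation

theorem MonoidAlgebra.isIntegral_int {G : Type*} [Group G] [Finite G] (z : MonoidAlgebra ℤ G) :
    IsIntegral ℤ z := by
  have : Module.Finite ℤ (MonoidAlgebra ℤ G) := inferInstance
  exact Algebra.IsIntegral.isIntegral z

/-- If the operator `∑ x ∈ S, ρ x` is the scalar `c`, then `c` is an algebraic integer. -/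
theorem Representation.isIntegral_of_sum_eq_smul_one {k G V : Type*} [Field k] [Group G]
    [Finite G] [AddCommGroup V] [Module k V] [Nontrivial V] (ρ : Representation k G V)
    (S : Finset G) (c : k) (hc : ∑ x ∈ S, ρ x = c • 1) : IsIntegral ℤ c := by
  have hz := (MonoidAlgebra.isIntegral_int (∑ x ∈ S, MonoidAlgebra.of ℤ G x)).map
    (MonoidAlgebra.lift ℤ (Module.End k V) G ρ)
  rw [map_sum] at hz
  simp only [MonoidAlgebra.lift_of] at hz
  rw [hc, ← Algebra.algebraMap_eq_smul_one] at hz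
  exact (isIntegral_algebraMap_iff (FaithfulSMul.algebraMap_injective k (Module.End k V))).mp hz

theorem classCard_eq_classCard_mk_mul {G : Type*} [Group G] [Fintype G] (N : Subgroup G)
    [N.Normal] (g : G) [DecidablePred fun x : G => IsConj g x ∧ (x : G ⧸ N) = g] :
    classCard g = classCard (g : G ⧸ N) *
      (Finset.univ.filter fun x : G => IsConj g x ∧ (x : G ⧸ N) = g).card := by
  classical
  have : Fintype (G ⧸ N) := Fintype.ofFinite _
  unfold classCard
  rw [Nat.card_eq_fintype_card, Nat.card_eq_fintype_card, Fintype.card_subtype,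
    Fintype.card_subtype]
  rw [Finset.card_eq_sum_card_fiberwise (f := fun x : G => (x : G ⧸ N))
    (t := Finset.univ.filter fun y => IsConj (g : G ⧸ N) y)]
  · rw [Finset.sum_const_nat]
    intro y hy
    obtain ⟨c, hc⟩ := isConj_iff.mp (Finset.mem_filter.mp hy).2
    obtain ⟨h, rfl⟩ := QuotientGroup.mk_surjective c
    symm
    refine Finset.card_equiv (MulAut.conj h).toEquiv fun x => ?_
    have hx : IsConj g (h * x * h⁻¹) ↔ IsConj g x :=
      ⟨fun H => H.trans (isConj_iff.mpr ⟨h⁻¹, by group⟩),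
        fun H => H.trans (isConj_iff.mpr ⟨h, rfl⟩)⟩
    simp [hx, ← hc, -isConj_iff]
  · intro x hx
    simp only [Finset.coe_filter, Finset.mem_univ, true_and, Set.mem_ofPred_eq] at hx ⊢
    exact (QuotientGroup.mk' N).map_isConj hx

open Classical in
/-- If the restriction of `V` to `N` has only scalar endomorphisms, then the sum of the character
of `V` over the conjugates of `g` in `gN`, divided by the degree, is an algebraic integer. -/
theorem FDRep.isIntegral_card_mul_character_div {G : Type} [Group G] [Fintype G] (N : Subgroup G)
    [N.Normal] (V : FDRep ℂ G)
    (hV : ∀ f : Module.End ℂ V, (∀ n : N, f * V.ρ n = V.ρ n * f) → ∃ c : ℂ, f = c • 1) (g : G) :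
    IsIntegral ℤ (((Finset.univ.filter fun x : G => IsConj g x ∧ (x : G ⧸ N) = g).card : ℂ) *
      V.character g / V.character 1) := by
  rcases subsingleton_or_nontrivial V with hsub | hnon
  · rw [FDRep.char_one, Module.finrank_zero_of_subsingleton]
    simpa using isIntegral_zero
  set S := Finset.univ.filter fun x : G => IsConj g x ∧ (x : G ⧸ N) = g with hS
  obtain ⟨c, hc⟩ := hV (∑ x ∈ S, V.ρ x) fun n => by
    rw [Finset.sum_mul, Finset.mul_sum]
    symm
    refine Finset.sum_equiv (MulAut.conj (n : G)).toEquiv (fun x => ?_) fun x _ => ?_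
    · have hx : IsConj g (n * x * (n : G)⁻¹) ↔ IsConj g x :=
        ⟨fun H => H.trans (isConj_iff.mpr ⟨(n : G)⁻¹, by group⟩),
          fun H => H.trans (isConj_iff.mpr ⟨n, rfl⟩)⟩
      have hn : ((n : G) : G ⧸ N) = 1 := (QuotientGroup.eq_one_iff _).mpr n.2
      simp [hS, hx, hn, -isConj_iff]
    · simp [← map_mul]
  have htr := congrArg (LinearMap.trace ℂ V) hc
  have hconst : ∀ x ∈ S, LinearMap.trace ℂ V (V.ρ x) = V.character g := fun x hx => by
    obtain ⟨h, rfl⟩ := isConj_iff.mp (Finset.mem_filter.mp hx).2.1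
    exact V.char_conj g h
  rw [map_sum, Finset.sum_congr rfl hconst, Finset.sum_const, map_smul, LinearMap.trace_one,
    nsmul_eq_mul, smul_eq_mul] at htr
  have hd : (Module.finrank ℂ V : ℂ) ≠ 0 := Nat.cast_ne_zero.mpr Module.finrank_pos.ne'
  rw [FDRep.char_one, htr, mul_div_cancel_right₀ _ hd]
  exact Representation.isIntegral_of_sum_eq_smul_one V.ρ S c hc

/-- If `V` restricts irreducibly to `N`, then its character has norm one on each coset of `N`. -/
theorem FDRep.sum_coset_character_mul_character_inv {G : Type} [Group G] (N : Subgroup G)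
    [Fintype N] (V : FDRep ℂ G) (hd : V.character 1 ≠ 0)
    (hV : ∀ f : Module.End ℂ V, (∀ n : N, f * V.ρ n = V.ρ n * f) → ∃ c : ℂ, f = c • 1) (g : G) :
    ∑ n : N, V.character (g * n) * V.character (g * n)⁻¹ = Nat.card N := by
  rw [FDRep.char_one] at hd
  have h := Representation.finrank_mul_sum_trace_mul_trace (V.ρ.comp N.subtype) hV
    (V.ρ g) (V.ρ g⁻¹)
  rw [← map_mul, mul_inv_cancel, map_one, LinearMap.trace_one, mul_comm (Nat.card N : ℂ)] at h
  rw [← mul_left_cancel₀ hd h]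
  refine Finset.sum_congr rfl fun n _ => ?_
  simp [FDRep.character, mul_inv_rev]

/-- If `V` restricts irreducibly to `N`, then tensoring with `V` takes the inflation of a simple
representation of `G ⧸ N` to a simple representation of `G`. -/
theorem IsIrredChar.inflate_mul_character {G : Type} [Group G] [Finite G] (N : Subgroup G)
    [N.Normal] {μ : G ⧸ N → ℂ} (hμ : IsIrredChar (G ⧸ N) μ) (V : FDRep ℂ G)
    (hd : V.character 1 ≠ 0)
    (hV : ∀ f : Module.End ℂ V, (∀ n : N, f * V.ρ n = V.ρ n * f) → ∃ c : ℂ, f = c • 1) :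
    IsIrredChar G fun g => μ g * V.character g := by
  classical
  have := Fintype.ofFinite G
  have := Fintype.ofFinite (G ⧸ N)
  obtain ⟨W, hW, hWμ⟩ := hμ
  let U : FDRep ℂ G := FDRep.of (Representation.tprod (W.ρ.comp (QuotientGroup.mk' N)) V.ρ)
  have hU (g : G) : U.character g = μ g * V.character g := by
    rw [← hWμ]
    exact LinearMap.trace_tensorProduct' (W.ρ (g : G ⧸ N)) (V.ρ g)
  refine ⟨U, ?_, hU⟩
  rw [FDRep.simple_iff_char_is_norm_one] at hW ⊢
  simp only [hU, hWμ] at hW ⊢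
  have hmk (q : G ⧸ N) (n : N) : ((q.out * n : G) : G ⧸ N) = q := by
    rw [QuotientGroup.mk_mul_of_mem _ n.2, QuotientGroup.out_eq']
  have hbij : Function.Bijective fun x : (G ⧸ N) × N => x.1.out * (x.2 : G) := by
    refine ⟨fun ⟨q, n⟩ ⟨r, m⟩ h => ?_, fun g => ?_⟩
    · obtain rfl : q = r := by rw [← hmk q n, ← hmk r m]; exact congrArg _ h
      exact congrArg _ (Subtype.ext (mul_left_cancel h))
    · have hg : (g : G ⧸ N).out⁻¹ * g ∈ N := by
        rw [← QuotientGroup.eq, QuotientGroup.out_eq']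
      exact ⟨((g : G ⧸ N), ⟨_, hg⟩), mul_inv_cancel_left _ _⟩
  have hterm (q : G ⧸ N) : ∑ n : N, μ ((q.out * n : G) : G ⧸ N) * V.character (q.out * n) *
      (μ (((q.out * n)⁻¹ : G) : G ⧸ N) * V.character (q.out * n)⁻¹) =
      μ q * μ q⁻¹ * Nat.card N := by
    rw [← V.sum_coset_character_mul_character_inv N hd hV q.out, Finset.mul_sum]
    refine Finset.sum_congr rfl fun n _ => ?_
    rw [QuotientGroup.mk_inv, hmk]
    ring
  rw [← hbij.sum_comp, Fintype.sum_prod_type]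
  simp only [hterm]
  rw [← Finset.sum_mul, hW, ← Nat.cast_mul, ← Subgroup.card_eq_card_quotient_mul_card_subgroup]

/-- A representation whose restriction to `N` has an irreducible character has only scalar
`N`-endomorphisms. -/
theorem FDRep.exists_eq_smul_one_of_isIrredChar {G : Type} [Group G] (N : Subgroup G) [Finite N]
    (V : FDRep ℂ G) (h : IsIrredChar N fun n => V.character n) (f : Module.End ℂ V)
    (hf : ∀ n : N, f * V.ρ n = V.ρ n * f) : ∃ c : ℂ, f = c • 1 := by
  have := Fintype.ofFinite N
  have := invertibleOfNonzero (NeZero.ne (Nat.card N : ℂ))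
  obtain ⟨W, hW, hWV⟩ := h
  rw [FDRep.simple_iff_char_is_norm_one] at hW
  simp only [hWV] at hW
  have hrank := Representation.card_inv_mul_sum_char_mul_char_eq_finrank
    (V.ρ.comp N.subtype) (V.ρ.comp N.subtype)
  refine Representation.exists_eq_smul_one_of_finrank_intertwiningMap (V.ρ.comp N.subtype)
    ?_ f hf
  rw [← Nat.cast_inj (R := ℂ), ← hrank, Nat.cast_one]
  exact (congrArg _ hW).trans (inv_mul_cancel_of_invertible _)

/-- If `θ ∈ Irr(B₀(N))` extends to `χ ∈ Irr(B₀(G))`, then for every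
`μ ∈ Irr(B₀(G/N))` the product `μχ` lies in `Irr(B₀(G))`. -/
theorem mul_mem_principalBlock (p : ℕ) (hp : p.Prime) (G : Type) [Group G] [Finite G]
    (N : Subgroup G) (hN : N.Normal)
    (M : Ideal (integralClosure ℤ ℂ)) (hM : M.IsMaximal)
    (hpM : (p : integralClosure ℤ ℂ) ∈ M)
    (θ : ↥N → ℂ) (hθirr : IsIrredChar ↥N θ) (hθB : InPrincipalBlock ↥N M θ)
    (χ : G → ℂ) (hχirr : IsIrredChar G χ) (hχB : InPrincipalBlock G M χ)
    (hext : ∀ n : ↥N, χ ↑n = θ n)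
    (μ : G ⧸ N → ℂ) (hμirr : IsIrredChar (G ⧸ N) μ)
    (hμB : InPrincipalBlock (G ⧸ N) M μ) :
    IsIrredChar G (fun g => μ (↑g) * χ g) ∧
      InPrincipalBlock G M (fun g => μ (↑g) * χ g) := by
  classical
  have := Fintype.ofFinite G
  obtain ⟨V, hVsimple, hVχ⟩ := hχirr
  obtain rfl : V.character = χ := funext hVχ
  obtain rfl : (fun n : N => V.character n) = θ := funext hext
  have hV := V.exists_eq_smul_one_of_isIrredChar N hθirr
  have hd : V.character 1 ≠ 0 := by
    rw [FDRep.char_one, Nat.cast_ne_zero]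
    intro h0
    have hnorm := V.simple_iff_char_is_norm_one.mp hVsimple
    have : Subsingleton V := Module.finrank_zero_iff.mp h0
    have hzero (g : G) : V.character g = 0 := by
      rw [FDRep.character, Subsingleton.elim (V.ρ g) 0, map_zero]
    simp only [hzero, mul_zero, Finset.sum_const_zero] at hnorm
    exact NeZero.ne (Nat.card G : ℂ) hnorm.symm
  refine ⟨hμirr.inflate_mul_character N V hd hV, fun g => ?_⟩
  obtain ⟨x, hx, hxM⟩ := hμB g
  obtain ⟨y, hy, hyM⟩ := hχB g
  refine ⟨x * ⟨_, V.isIntegral_card_mul_character_div N hV g⟩ + y, ?_,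
    M.add_mem (M.mul_mem_right _ hxM) hyM⟩
  simp only [classCard_eq_classCard_mk_mul N g, QuotientGroup.mk_one] at hy ⊢
  push_cast at hx hy ⊢
  rw [hx, hy]
  ring
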